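/- There exists a constant C > 0, independent of f, a and b, such that the following holds: if f : ℝ → E is three times continuously differentiable on [a, b] and m = (a + b)/2, then ‖f'(m) − (f(b) − f(a))/(b − a)‖² ≤ C·(b − a)³·∫_a^b ‖f'''(s)‖² ds. -/

import Mathlib

open MeasureTheory intervalIntegral

/-- Cauchy-Schwarz against the constant function `1` on a compact interval. -/
lemma sq_intervalIntegral_le_mul_intervalIntegral_sq {g : ℝ → ℝ} {a b : ℝ} (hab : a < b)
    (hg : ContinuousOn g (Set.Icc a b)) :
    (∫ s in a..b, g s) ^ 2 ≤ (b - a) * ∫ s in a..b, g s ^ 2 := by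
  set I := ∫ s in a..b, g s with hI
  set c := I / (b - a) with hc
  have hba : 0 < b - a := sub_pos.2 hab
  have hg1 : IntervalIntegrable g volume a b := hg.intervalIntegrable_of_Icc hab.le
  have hg2 : IntervalIntegrable (fun s => g s ^ 2) volume a b :=
    (hg.pow 2).intervalIntegrable_of_Icc hab.le
  have hcI : c * (b - a) = I := div_mul_cancel₀ _ hba.ne'
  have hnonneg : 0 ≤ ∫ s in a..b, (g s - c) ^ 2 :=
    integral_nonneg hab.le fun s _ => sq_nonneg _
  have hexpand : ∫ s in a..b, (g s - c) ^ 2 =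
      (∫ s in a..b, g s ^ 2) - 2 * c * I + (b - a) * c ^ 2 := by
    have : ∀ s, (g s - c) ^ 2 = g s ^ 2 - 2 * c * g s + c ^ 2 := fun s => by ring
    simp_rw [this]
    rw [integral_add (hg2.sub (hg1.const_mul _)) intervalIntegrable_const,
      integral_sub hg2 (hg1.const_mul _), intervalIntegral.integral_const_mul, intervalIntegral.integral_const, smul_eq_mul]
  rw [hexpand] at hnonneg
  have := mul_nonneg hba.le hnonneg
  rw [← hcI] at this ⊢
  linarith

/-- On `[a, b]`, the variation of a function is at most the integral of the norm of its
derivative. -/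
lemma norm_sub_le_intervalIntegral_norm_of_hasDerivWithinAt
    {E : Type*} [NormedAddCommGroup E] [NormedSpace ℝ E] [CompleteSpace E]
    {g g' : ℝ → E} {a b x y : ℝ} (hab : a ≤ b)
    (hg : ∀ t ∈ Set.Icc a b, HasDerivWithinAt g (g' t) (Set.Icc a b) t)
    (hg' : ContinuousOn g' (Set.Icc a b)) (hx : x ∈ Set.Icc a b) (hy : y ∈ Set.Icc a b) :
    ‖g y - g x‖ ≤ ∫ s in a..b, ‖g' s‖ := by
  wlog hxy : x ≤ y generalizing x y
  · rw [norm_sub_rev]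
    exact this hy hx (le_of_not_ge hxy)
  have hsub : Set.Icc x y ⊆ Set.Icc a b := Set.Icc_subset_Icc hx.1 hy.2
  have hftc : ∫ s in x..y, g' s = g y - g x :=
    integral_eq_sub_of_hasDerivAt_of_le hxy
      (fun t ht => ((hg t (hsub ht)).continuousWithinAt).mono hsub)
      (fun t ht => (hg t (hsub (Set.Ioo_subset_Icc_self ht))).hasDerivAt
        (Icc_mem_nhds (hx.1.trans_lt ht.1) (ht.2.trans_le hy.2)))
      ((hg'.mono hsub).intervalIntegrable_of_Icc hxy)
  rw [← hftc]
  exact (intervalIntegral.norm_integral_le_integral_norm hxy).trans <|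
    integral_mono_interval hx.1 hxy hy.2 (Filter.Eventually.of_forall fun _ => norm_nonneg _)
      (hg'.norm.intervalIntegrable_of_Icc hab)

/-- A bound on the oscillation of the second derivative about the midpoint controls the error of
the midpoint difference quotient. -/
lemma norm_sub_sub_smul_midpoint_deriv_le
    {E : Type*} [NormedAddCommGroup E] [NormedSpace ℝ E]
    {f f' f'' : ℝ → E} {a b K : ℝ} (hab : a ≤ b)
    (hf : ∀ t ∈ Set.Icc a b, HasDerivWithinAt f (f' t) (Set.Icc a b) t)
    (hf' : ∀ t ∈ Set.Icc a b, HasDerivWithinAt f' (f'' t) (Set.Icc a b) t)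
    (hK : ∀ t ∈ Set.Icc a b, ‖f'' t - f'' ((a + b) / 2)‖ ≤ K) :
    ‖f b - f a - (b - a) • f' ((a + b) / 2)‖ ≤ K * (b - a) ^ 2 := by
  set m := (a + b) / 2 with hm
  have hmem : m ∈ Set.Icc a b := ⟨by linarith, by linarith⟩
  have hK0 : 0 ≤ K := (norm_nonneg _).trans (hK m hmem)
  have hlin (t : ℝ) : HasDerivWithinAt (fun s => s - m) 1 (Set.Icc a b) t :=
    (hasDerivWithinAt_id t _).sub_const m
  have hbound' : ∀ t ∈ Set.Icc a b, ‖f' t - f' m - (t - m) • f'' m‖ ≤ K * (b - a) := by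
    intro t ht
    have hder : ∀ s ∈ Set.Icc a b, HasDerivWithinAt (fun s => f' s - (s - m) • f'' m)
        (f'' s - f'' m) (Set.Icc a b) s := fun s hs => by
      simpa using (hf' s hs).fun_sub ((hlin s).smul_const (f'' m))
    have h := (convex_Icc a b).norm_image_sub_le_of_norm_hasDerivWithin_le hder hK hmem ht
    have hdist : ‖t - m‖ ≤ b - a := by
      rw [Real.norm_eq_abs, abs_le]
      constructor <;> linarith [ht.1, ht.2, hmem.1, hmem.2]
    rw [sub_self, zero_smul, sub_zero, sub_right_comm] at h
    exact h.trans (by gcongr)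
  have hder : ∀ t ∈ Set.Icc a b,
      HasDerivWithinAt (fun t => f t - (t - m) • f' m - ((t - m) ^ 2 / 2) • f'' m)
        (f' t - f' m - (t - m) • f'' m) (Set.Icc a b) t := fun t ht => by
    have hsq : HasDerivWithinAt (fun s => (s - m) ^ 2 / 2) (t - m) (Set.Icc a b) t := by
      simpa using ((hlin t).fun_pow 2).div_const 2
    simpa using ((hf t ht).fun_sub ((hlin t).smul_const (f' m))).fun_sub (hsq.smul_const (f'' m))
  have h := (convex_Icc a b).norm_image_sub_le_of_norm_hasDerivWithin_le hder hbound'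
    (Set.left_mem_Icc.2 hab) (Set.right_mem_Icc.2 hab)
  rw [Real.norm_of_nonneg (sub_nonneg.2 hab)] at h
  have herr : f b - (b - m) • f' m - ((b - m) ^ 2 / 2) • f'' m -
      (f a - (a - m) • f' m - ((a - m) ^ 2 / 2) • f'' m) = f b - f a - (b - a) • f' m := by
    rw [show (a - m) ^ 2 = (b - m) ^ 2 by rw [hm]; ring]
    module
  rw [herr] at h
  linarith

/-- Consistency estimate for the Crank–Nicolson time derivative: there is a constant `C > 0`,
independent of `f`, `a`, `b`, such that for `f : ℝ → E` three times continuously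
differentiable on `[a, b]` and `m = (a + b)/2`,
`‖f'(m) − (f b − f a)/(b − a)‖² ≤ C (b − a)³ ∫_a^b ‖f'''(s)‖² ds`. -/
theorem midpoint_derivative_consistency_estimate
    {E : Type*} [NormedAddCommGroup E] [InnerProductSpace ℝ E] [CompleteSpace E] :
    ∃ C : ℝ, 0 < C ∧ ∀ (f : ℝ → E) (a b : ℝ), a < b →
      ContDiffOn ℝ 3 f (Set.Icc a b) →
      ‖iteratedDerivWithin 1 f (Set.Icc a b) ((a + b) / 2) - (b - a)⁻¹ • (f b - f a)‖ ^ 2 ≤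
        C * (b - a) ^ 3 *
          ∫ s in a..b, ‖iteratedDerivWithin 3 f (Set.Icc a b) s‖ ^ 2 := by
  refine ⟨1, one_pos, fun f a b hab hf => ?_⟩
  have hba : 0 < b - a := sub_pos.2 hab
  have hs : UniqueDiffOn ℝ (Set.Icc a b) := uniqueDiffOn_Icc hab
  set D : ℕ → ℝ → E := fun n => iteratedDerivWithin n f (Set.Icc a b) with hD
  have hder : ∀ n < 3, ∀ t ∈ Set.Icc a b,
      HasDerivWithinAt (D n) (D (n + 1) t) (Set.Icc a b) t := fun n hn t ht => by
    simp only [hD, iteratedDerivWithin_succ]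
    exact (hf.differentiableOn_iteratedDerivWithin (by exact_mod_cast hn) hs t ht).hasDerivWithinAt
  have hcont : ContinuousOn (D 3) (Set.Icc a b) :=
    hf.continuousOn_iteratedDerivWithin le_rfl hs
  have hf0 : D 0 = f := iteratedDerivWithin_zero
  set I := ∫ s in a..b, ‖D 3 s‖
  have hmem : (a + b) / 2 ∈ Set.Icc a b := ⟨by linarith, by linarith⟩
  have herr := norm_sub_sub_smul_midpoint_deriv_le hab.le (hf0 ▸ hder 0 (by norm_num))
    (hder 1 (by norm_num)) fun t ht => norm_sub_le_intervalIntegral_norm_of_hasDerivWithinAt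
      hab.le (hder 2 (by norm_num)) hcont hmem ht
  have hquot : ‖D 1 ((a + b) / 2) - (b - a)⁻¹ • (f b - f a)‖ ≤ I * (b - a) := by
    have herr_eq : D 1 ((a + b) / 2) - (b - a)⁻¹ • (f b - f a) =
        -((b - a)⁻¹ • (f b - f a - (b - a) • D 1 ((a + b) / 2))) := by
      rw [smul_sub _ (f b - f a), inv_smul_smul₀ hba.ne', neg_sub]
    rw [herr_eq, norm_neg, norm_smul, norm_inv, Real.norm_of_nonneg hba.le,
      inv_mul_le_iff₀ hba]
    linarith
  calc ‖D 1 ((a + b) / 2) - (b - a)⁻¹ • (f b - f a)‖ ^ 2 ≤ (I * (b - a)) ^ 2 := by gcongr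
    _ = (b - a) ^ 2 * I ^ 2 := by ring
    _ ≤ (b - a) ^ 2 * ((b - a) * ∫ s in a..b, ‖D 3 s‖ ^ 2) := by
        gcongr
        exact sq_intervalIntegral_le_mul_intervalIntegral_sq hab hcont.norm
    _ = 1 * (b - a) ^ 3 * ∫ s in a..b, ‖D 3 s‖ ^ 2 := by ring
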